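/- The creation and annihilation operators of the generalized algebraic Bethe ansatz commute in the shifted-gauge pattern: B_{k,l+1}(λ)B_{k+1,l}(μ) = B_{k,l+1}(μ)B_{k+1,l}(λ) and C_{k+1,l}(λ)C_{k,l+1}(μ) = C_{k+1,l}(μ)C_{k,l+1}(λ), for all λ, μ ∈ ℂ and all integers k, l. -/

import Mathlib

open Complex Matrix Finset
open scoped Kronecker

noncomputable section

/-- Jacobi theta function `θ₁(z|τ) = -i ∑_{n∈ℤ} (-1)^n exp(πi(n+1/2)²τ + (2n+1)iz)`. -/
def theta1 (z τ : ℂ) : ℂ :=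
  ∑' n : ℤ, -Complex.I * (-1 : ℂ) ^ n *
    Complex.exp ((Real.pi : ℂ) * Complex.I * ((n : ℂ) + 1 / 2) ^ 2 * τ +
      (2 * (n : ℂ) + 1) * Complex.I * z)

/-- Jacobi theta function `θ₄(z|τ) = ∑_{n∈ℤ} (-1)^n exp(πin²τ + 2inz)`. -/
def theta4 (z τ : ℂ) : ℂ :=
  ∑' n : ℤ, (-1 : ℂ) ^ n *
    Complex.exp ((Real.pi : ℂ) * Complex.I * (n : ℂ) ^ 2 * τ +
      2 * (n : ℂ) * Complex.I * z)

/-- `H(μ) = θ₁(πμ/2K | iK'/K)`, the Jacobi theta function with quasi-periods 2K, 2iK'. -/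
def HJ (K K' μ : ℂ) : ℂ := theta1 ((Real.pi : ℂ) * μ / (2 * K)) (Complex.I * K' / K)

/-- `Θ(μ) = θ₄(πμ/2K | iK'/K)`. -/
def ΘJ (K K' μ : ℂ) : ℂ := theta4 ((Real.pi : ℂ) * μ / (2 * K)) (Complex.I * K' / K)

/-- `g(μ) = H(μ)Θ(μ)`. -/
def gJ (K K' μ : ℂ) : ℂ := HJ K K' μ * ΘJ K K' μ

/-- `h(μ) = g(μ)Θ(0)`. -/
def hJ (K K' μ : ℂ) : ℂ := gJ K K' μ * ΘJ K K' 0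

/-- `τ_k = (s+t)/2 + 2kη − K`. -/
def τJ (K η s t : ℂ) (k : ℤ) : ℂ := (s + t) / 2 + 2 * (k : ℂ) * η - K

/-- `α(λ,μ) = h(λ−μ−2η)/h(λ−μ)`. -/
def αJ (K K' η lam mu : ℂ) : ℂ := hJ K K' (lam - mu - 2 * η) / hJ K K' (lam - mu)

/-- `β_k(λ,μ) = (h(2η)/h(μ−λ))·(h(τ_k+μ−λ)/h(τ_k))`. -/
def βJ (K K' η s t : ℂ) (k : ℤ) (lam mu : ℂ) : ℂ :=
  hJ K K' (2 * η) / hJ K K' (mu - lam) *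
    (hJ K K' (τJ K η s t k + mu - lam) / hJ K K' (τJ K η s t k))

/-- Pauli matrices. -/
def σx : Matrix (Fin 2) (Fin 2) ℂ := !![0, 1; 1, 0]
def σy : Matrix (Fin 2) (Fin 2) ℂ := !![0, -Complex.I; Complex.I, 0]
def σz : Matrix (Fin 2) (Fin 2) ℂ := !![1, 0; 0, -1]

/-- `w₄+w₃ = Θ(2η)Θ(μ−η)H(μ+η)` etc. -/
def w4p3 (K K' η μ : ℂ) : ℂ := ΘJ K K' (2 * η) * ΘJ K K' (μ - η) * HJ K K' (μ + η)
def w4m3 (K K' η μ : ℂ) : ℂ := ΘJ K K' (2 * η) * HJ K K' (μ - η) * ΘJ K K' (μ + η)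
def w1p2 (K K' η μ : ℂ) : ℂ := HJ K K' (2 * η) * ΘJ K K' (μ - η) * ΘJ K K' (μ + η)
def w1m2 (K K' η μ : ℂ) : ℂ := HJ K K' (2 * η) * HJ K K' (μ - η) * HJ K K' (μ + η)
def wc4 (K K' η μ : ℂ) : ℂ := (w4p3 K K' η μ + w4m3 K K' η μ) / 2
def wc3 (K K' η μ : ℂ) : ℂ := (w4p3 K K' η μ - w4m3 K K' η μ) / 2
def wc1 (K K' η μ : ℂ) : ℂ := (w1p2 K K' η μ + w1m2 K K' η μ) / 2
def wc2 (K K' η μ : ℂ) : ℂ := (w1p2 K K' η μ - w1m2 K K' η μ) / 2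

/-- The single-site `L`-operator, a 2×2 matrix in auxiliary space whose entries are
operators (2×2 matrices) on the site Hilbert space ℂ². -/
def Lsite (K K' η μ : ℂ) : Matrix (Fin 2) (Fin 2) (Matrix (Fin 2) (Fin 2) ℂ) :=
  !![wc4 K K' η μ • (1 : Matrix (Fin 2) (Fin 2) ℂ) + wc3 K K' η μ • σz,
      wc1 K K' η μ • σx - (Complex.I * wc2 K K' η μ) • σy;
      wc1 K K' η μ • σx + (Complex.I * wc2 K K' η μ) • σy,
      wc4 K K' η μ • (1 : Matrix (Fin 2) (Fin 2) ℂ) - wc3 K K' η μ • σz]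

/-- Entries of the R-matrix. -/
def aJ (K K' η lam mu : ℂ) : ℂ := ΘJ K K' (2*η) * ΘJ K K' (lam - mu) * HJ K K' (lam - mu + 2*η)
def bJ (K K' η lam mu : ℂ) : ℂ := HJ K K' (2*η) * ΘJ K K' (lam - mu) * ΘJ K K' (lam - mu + 2*η)
def cJ (K K' η lam mu : ℂ) : ℂ := ΘJ K K' (2*η) * HJ K K' (lam - mu) * ΘJ K K' (lam - mu + 2*η)
def dJ (K K' η lam mu : ℂ) : ℂ := HJ K K' (2*η) * HJ K K' (lam - mu) * HJ K K' (lam - mu + 2*η)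

/-- The 4×4 R-matrix, with rows/columns indexed by `Fin 2 × Fin 2`
(the basis order (0,0),(0,1),(1,0),(1,1) corresponds to rows 1,2,3,4):
nonzero entries R₁₁ = R₄₄ = a, R₂₂ = R₃₃ = b, R₂₃ = R₃₂ = c, R₁₄ = R₄₁ = d. -/
def Rc (K K' η lam mu : ℂ) : Matrix (Fin 2 × Fin 2) (Fin 2 × Fin 2) ℂ :=
  Matrix.of fun p q =>
    if p = q then (if p.1 = p.2 then aJ K K' η lam mu else bJ K K' η lam mu)
    else if q = (p.2, p.1) ∧ p.1 ≠ p.2 then cJ K K' η lam mu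
    else if p.1 = p.2 ∧ q.1 = q.2 then dJ K K' η lam mu
    else 0

/-- Spin configurations of a chain of length L: the index set of the basis of (ℂ²)^{⊗L}. -/
abbrev Conf (L : ℕ) := Fin L → Fin 2

/-- Operators on (ℂ²)^{⊗L}. -/
abbrev OpC (L : ℕ) := Matrix (Conf L) (Conf L) ℂ

/-- Embedding of a one-site operator at site `n` of the chain (identity elsewhere). -/
def embed (L : ℕ) (n : Fin L) (A : Matrix (Fin 2) (Fin 2) ℂ) : OpC L :=
  Matrix.of fun f g => A (f n) (g n) * ∏ m ∈ univ.erase n, if f m = g m then 1 else 0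

/-- The `L`-operator at site `n`, entries acting on (ℂ²)^{⊗L}. -/
def Lop (K K' η : ℂ) (L : ℕ) (n : Fin L) (μ : ℂ) : Matrix (Fin 2) (Fin 2) (OpC L) :=
  (Lsite K K' η μ).map (embed L n)

/-- The monodromy matrix `T(μ) = L_L(μ)···L_1(μ)` (site n = i+1 for `i : Fin L`). -/
def Tm (K K' η : ℂ) (L : ℕ) (μ : ℂ) : Matrix (Fin 2) (Fin 2) (OpC L) :=
  (List.ofFn fun i : Fin L => Lop K K' η L i.rev μ).prod

def Amat (K K' η : ℂ) (L : ℕ) (μ : ℂ) : OpC L := Tm K K' η L μ 0 0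
def Bmat (K K' η : ℂ) (L : ℕ) (μ : ℂ) : OpC L := Tm K K' η L μ 0 1
def Cmat (K K' η : ℂ) (L : ℕ) (μ : ℂ) : OpC L := Tm K K' η L μ 1 0
def Dmat (K K' η : ℂ) (L : ℕ) (μ : ℂ) : OpC L := Tm K K' η L μ 1 1

/-- The gauge matrix `M_k(μ)`. -/
def Mg (K K' η s t : ℂ) (k : ℤ) (μ : ℂ) : Matrix (Fin 2) (Fin 2) ℂ :=
  !![HJ K K' (s + 2 * (k : ℂ) * η - μ), (gJ K K' (τJ K η s t k))⁻¹ * HJ K K' (t + 2 * (k : ℂ) * η + μ);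
     ΘJ K K' (s + 2 * (k : ℂ) * η - μ), (gJ K K' (τJ K η s t k))⁻¹ * ΘJ K K' (t + 2 * (k : ℂ) * η + μ)]

/-- View a scalar 2×2 matrix as a 2×2 matrix of operators on (ℂ²)^{⊗L}. -/
def toOp (L : ℕ) (A : Matrix (Fin 2) (Fin 2) ℂ) : Matrix (Fin 2) (Fin 2) (OpC L) :=
  A.map fun z => z • (1 : OpC L)

/-- View a scalar 2×2 matrix as a 2×2 matrix of one-site operators. -/
def toOp2 (A : Matrix (Fin 2) (Fin 2) ℂ) : Matrix (Fin 2) (Fin 2) (Matrix (Fin 2) (Fin 2) ℂ) :=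
  A.map fun z => z • (1 : Matrix (Fin 2) (Fin 2) ℂ)

/-- The gauge-transformed monodromy matrix `T_{k,l}(μ) = M_k(μ)⁻¹ T(μ) M_l(μ)`. -/
def Tg (K K' η s t : ℂ) (L : ℕ) (k l : ℤ) (μ : ℂ) : Matrix (Fin 2) (Fin 2) (OpC L) :=
  toOp L (Mg K K' η s t k μ)⁻¹ * Tm K K' η L μ * toOp L (Mg K K' η s t l μ)

def Ag (K K' η s t : ℂ) (L : ℕ) (k l : ℤ) (μ : ℂ) : OpC L := Tg K K' η s t L k l μ 0 0
def Bg (K K' η s t : ℂ) (L : ℕ) (k l : ℤ) (μ : ℂ) : OpC L := Tg K K' η s t L k l μ 0 1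
def Cg (K K' η s t : ℂ) (L : ℕ) (k l : ℤ) (μ : ℂ) : OpC L := Tg K K' η s t L k l μ 1 0
def Dg (K K' η s t : ℂ) (L : ℕ) (k l : ℤ) (μ : ℂ) : OpC L := Tg K K' η s t L k l μ 1 1

/-- The gauge-transformed one-site L-operator `L_n^l(μ) = M_{n+l}(μ)⁻¹ L_n(μ) M_{n+l−1}(μ)`. -/
def Lg (K K' η s t : ℂ) (n l : ℤ) (μ : ℂ) : Matrix (Fin 2) (Fin 2) (Matrix (Fin 2) (Fin 2) ℂ) :=
  toOp2 (Mg K K' η s t (n + l) μ)⁻¹ * Lsite K K' η μ * toOp2 (Mg K K' η s t (n + l - 1) μ)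

/-- The local vacuum `|ω_n^l⟩` (depending on n, l only through nl = n + l):
`H(s+(2(n+l)−1)η)|↑⟩ + Θ(s+(2(n+l)−1)η)|↓⟩`. -/
def ωvec (K K' η s : ℂ) (nl : ℤ) : Fin 2 → ℂ :=
  ![HJ K K' (s + (2 * (nl : ℂ) - 1) * η), ΘJ K K' (s + (2 * (nl : ℂ) - 1) * η)]

/-- The dual local vacuum `⟨ω_n^l| = Θ(t+(2(n+l)−1)η)⟨↑| − H(t+(2(n+l)−1)η)⟨↓|`. -/
def ωdual (K K' η t : ℂ) (nl : ℤ) : Fin 2 → ℂ :=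
  ![ΘJ K K' (t + (2 * (nl : ℂ) - 1) * η), -HJ K K' (t + (2 * (nl : ℂ) - 1) * η)]

/-- The generating vector `|l⟩ = |ω_L^l⟩⊗···⊗|ω_1^l⟩` (site n = i+1). -/
def genV (K K' η s : ℂ) (L : ℕ) (l : ℤ) : Conf L → ℂ :=
  fun f => ∏ i : Fin L, ωvec K K' η s ((i : ℕ) + 1 + l) (f i)

/-- The dual generating vector `⟨l| = ⟨ω_1^l|⊗···⊗⟨ω_L^l|`. -/
def genD (K K' η t : ℂ) (L : ℕ) (l : ℤ) : Conf L → ℂ :=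
  fun f => ∏ i : Fin L, ωdual K K' η t ((i : ℕ) + 1 + l) (f i)

/-- The n-particle Bethe vector
`|Ψ_l^n(λ₁,…,λ_n)⟩ = B_{l+N−n+1,l−N+n−1}(λ₁)···B_{l+N,l−N}(λ_n)|l−N⟩`
(for n = N this is `|Ψ_l(λ₁,…,λ_N)⟩ = B_{l+1,l−1}(λ₁)···B_{l+N,l−N}(λ_N)|l−N⟩`). -/
def psiB (K K' η s t : ℂ) (L N n : ℕ) (l : ℤ) (lam : Fin n → ℂ) : Conf L → ℂ :=
  ((List.ofFn fun j : Fin n =>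
      Bg K K' η s t L (l + (N : ℤ) - (n : ℤ) + 1 + (j : ℕ)) (l - (N : ℤ) + (n : ℤ) - 1 - (j : ℕ))
        (lam j)).prod).mulVec
    (genV K K' η s L (l - (N : ℤ)))

/-- The dual n-particle Bethe vector
`⟨Ψ_l^n(λ₁,…,λ_n)| = ⟨l−N+1| C_{l+N−1,l−N+1}(λ_n)···C_{l+N−n,l−N+n}(λ₁)`. -/
def psiC (K K' η s t : ℂ) (L N n : ℕ) (l : ℤ) (lam : Fin n → ℂ) : Conf L → ℂ :=
  Matrix.vecMul (genD K K' η t L (l - (N : ℤ) + 1))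
    ((List.ofFn fun j : Fin n =>
        Cg K K' η s t L (l + (N : ℤ) - 1 - (j : ℕ)) (l - (N : ℤ) + 1 + (j : ℕ))
          (lam j.rev)).prod)

/-- `r(λ) = (h(λ+η)/h(λ−η))^L`. -/
def rJ (K K' η : ℂ) (L : ℕ) (lam : ℂ) : ℂ := (hJ K K' (lam + η) / hJ K K' (lam - η)) ^ L

/-- The eigenvalue `Λ_m(μ;{λ_k})`. -/
def ΛJ (K K' η : ℂ) (L Q m : ℕ) {n : ℕ} (lam : Fin n → ℂ) (μ : ℂ) : ℂ :=
  Complex.exp (2 * (Real.pi : ℂ) * Complex.I * (m : ℂ) / (Q : ℂ)) *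
      ((hJ K K' (μ + η)) ^ L * ∏ k, αJ K K' η μ (lam k)) +
    Complex.exp (-(2 * (Real.pi : ℂ) * Complex.I * (m : ℂ) / (Q : ℂ))) *
      ((hJ K K' (μ - η)) ^ L * ∏ k, αJ K K' η (lam k) μ)

/-- The sum of norms of the Bethe vectors
`M_n(λ₁,…,λ_n) = (1/Q) Σ_{l=0}^{Q−1} ⟨Ψ_l^n(λ)|Ψ_l^n(λ)⟩`. -/
def MnS (K K' η s t : ℂ) (Q L N n : ℕ) (lam : Fin n → ℂ) : ℂ :=
  (Q : ℂ)⁻¹ * ∑ l ∈ Finset.range Q,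
    dotProduct (psiC K K' η s t L N n (l : ℤ) lam) (psiB K K' η s t L N n (l : ℤ) lam)

/-- `c_L = ⟨l|l−1⟩` (evaluated at l = 0, being independent of l). -/
def cLJ (K K' η s t : ℂ) (L : ℕ) : ℂ :=
  dotProduct (genD K K' η t L 0) (genV K K' η s L (-1))

/-- The eigenvector `|Φ_m⟩ = (1/√Q) Σ_{l=0}^{Q−1} e^{2πilm/Q} |Ψ_l⟩`. -/
def PhiV (K K' η s t : ℂ) (Q L N m : ℕ) (lam : Fin N → ℂ) : Conf L → ℂ :=
  ((Real.sqrt Q : ℝ) : ℂ)⁻¹ • ∑ l ∈ Finset.range Q,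
    Complex.exp (2 * (Real.pi : ℂ) * Complex.I * (l : ℂ) * (m : ℂ) / (Q : ℂ)) •
      psiB K K' η s t L N N (l : ℤ) lam

/-- The dual eigenvector `⟨Φ_m| = (1/√Q) Σ_{l=0}^{Q−1} e^{−2πilm/Q} ⟨Ψ_l|`. -/
def PhiD (K K' η s t : ℂ) (Q L N m : ℕ) (lam : Fin N → ℂ) : Conf L → ℂ :=
  ((Real.sqrt Q : ℝ) : ℂ)⁻¹ • ∑ l ∈ Finset.range Q,
    Complex.exp (-(2 * (Real.pi : ℂ) * Complex.I * (l : ℂ) * (m : ℂ) / (Q : ℂ))) •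
      psiC K K' η s t L N N (l : ℤ) lam

/-- `φ_k = log( r(λ_k) ∏_{i≠k} α(λ_k,λ_i)/α(λ_i,λ_k) )`. -/
def phiG (K K' η : ℂ) (L : ℕ) {n : ℕ} (lam : Fin n → ℂ) (k : Fin n) : ℂ :=
  Complex.log (rJ K K' η L (lam k) *
    ∏ i ∈ univ.erase k, αJ K K' η (lam k) (lam i) / αJ K K' η (lam i) (lam k))


def parEquiv : (ℤ × ℤ) ⊕ (ℤ × ℤ) ≃ ℤ × ℤ where
  toFun := Sum.elim (fun p => (p.1 + p.2, p.1 - p.2)) (fun p => (p.1 + p.2 + 1, p.1 - p.2))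
  invFun := fun q => if (q.1 + q.2) % 2 = 0 then Sum.inl ((q.1 + q.2) / 2, (q.1 - q.2) / 2)
    else Sum.inr ((q.1 + q.2) / 2, (q.1 - q.2) / 2)
  left_inv := by
    rintro (⟨a, b⟩ | ⟨a, b⟩)
    · have h : (a + b + (a - b)) % 2 = 0 := by omega
      simp only [Sum.elim_inl, h, if_true]
      congr 2 <;> omega
    · have h : ¬ (a + b + 1 + (a - b)) % 2 = 0 := by omega
      simp only [Sum.elim_inr, h, if_false]
      congr 2 <;> omega
  right_inv := by
    rintro ⟨a, b⟩
    by_cases h : (a + b) % 2 = 0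
    · simp only [h, if_true, Sum.elim_inl, Prod.mk.injEq]
      constructor <;> omega
    · simp only [h, if_false, Sum.elim_inr, Prod.mk.injEq]
      constructor <;> omega

lemma tsum_par (A B C1 C2 D1 D2 : ℤ → ℂ) (hA : Summable fun n => ‖A n‖)
    (hB : Summable fun n => ‖B n‖) (hC1 : Summable fun n => ‖C1 n‖)
    (hC2 : Summable fun n => ‖C2 n‖) (hD1 : Summable fun n => ‖D1 n‖)
    (hD2 : Summable fun n => ‖D2 n‖)
    (h1 : ∀ j l, A (j + l) * B (j - l) = C1 j * C2 l)
    (h2 : ∀ j l, A (j + l + 1) * B (j - l) = D1 j * D2 l) :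
    (∑' n, A n) * (∑' n, B n) =
      (∑' n, C1 n) * (∑' n, C2 n) + (∑' n, D1 n) * (∑' n, D2 n) := by
  rw [tsum_mul_tsum_of_summable_norm hA hB, tsum_mul_tsum_of_summable_norm hC1 hC2,
    tsum_mul_tsum_of_summable_norm hD1 hD2]
  have sC := (summable_mul_of_summable_norm hC1 hC2).hasSum
  have sD := (summable_mul_of_summable_norm hD1 hD2).hasSum
  rw [← parEquiv.tsum_eq]
  apply HasSum.tsum_eq
  refine HasSum.sum ?_ ?_
  · convert sC using 1
    funext p
    simp [parEquiv, h1]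
  · convert sD using 1
    funext p
    simp [parEquiv, h2]

lemma summable_gauss {τ : ℂ} (hτ : 0 < τ.im) (z c : ℂ) (f : ℤ → ℂ)
    (hf : ∀ n, ‖f n‖ = ‖c‖ * ‖jacobiTheta₂_term n z τ‖) : Summable fun n => ‖f n‖ := by
  simp_rw [hf]
  exact (((summable_jacobiTheta₂_term_iff z τ).2 hτ).norm).mul_left _

def thA (n : ℤ) (z τ : ℂ) : ℂ := cexp ((Real.pi : ℂ) * I * (n : ℂ) ^ 2 * τ + 2 * (n : ℂ) * I * z)
def thB (n : ℤ) (z τ : ℂ) : ℂ :=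
  cexp ((Real.pi : ℂ) * I * ((n : ℂ) + 1 / 2) ^ 2 * τ + (2 * (n : ℂ) + 1) * I * z)
def thE (n : ℤ) (z τ : ℂ) : ℂ :=
  cexp ((Real.pi : ℂ) * I * (2 * (n : ℂ) + 1 / 2) ^ 2 * (τ / 2) + (4 * (n : ℂ) + 1) * I * z)

lemma pi_ne : (Real.pi : ℂ) ≠ 0 := by exact_mod_cast Real.pi_ne_zero

lemma thA_eq (n : ℤ) (z τ : ℂ) : thA n z τ = jacobiTheta₂_term n (z / Real.pi) τ := by
  have := pi_ne
  unfold thA jacobiTheta₂_term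
  congr 1
  field_simp
  ring

lemma thB_eq (n : ℤ) (z τ : ℂ) : thB n z τ =
    cexp ((Real.pi : ℂ) * I * τ / 4 + I * z) * jacobiTheta₂_term n (z / Real.pi + τ / 2) τ := by
  have := pi_ne
  unfold thB jacobiTheta₂_term
  rw [← Complex.exp_add]
  congr 1
  field_simp
  ring

lemma thE_eq (n : ℤ) (z τ : ℂ) : thE n z τ =
    cexp ((Real.pi : ℂ) * I * τ / 8 + I * z) *
      jacobiTheta₂_term n (2 * z / Real.pi + τ / 2) (2 * τ) := by
  have := pi_ne
  unfold thE jacobiTheta₂_term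
  rw [← Complex.exp_add]
  congr 1
  field_simp
  ring

lemma sA {τ : ℂ} (hτ : 0 < τ.im) (z c : ℂ) : Summable fun n => ‖c * thA n z τ‖ :=
  summable_gauss hτ (z / Real.pi) c _ fun n => by rw [thA_eq, norm_mul]
lemma sA' {τ : ℂ} (hτ : 0 < τ.im) (z c : ℂ) : Summable fun n : ℤ => ‖c * (-1) ^ n * thA n z τ‖ :=
  summable_gauss hτ (z / Real.pi) c _ fun n => by rw [thA_eq, norm_mul, norm_mul]; simp
lemma sB {τ : ℂ} (hτ : 0 < τ.im) (z c : ℂ) : Summable fun n => ‖c * thB n z τ‖ :=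
  summable_gauss hτ _ (c * _) _ fun n => by rw [thB_eq, ← mul_assoc, norm_mul]
lemma sB' {τ : ℂ} (hτ : 0 < τ.im) (z c : ℂ) : Summable fun n : ℤ => ‖c * (-1) ^ n * thB n z τ‖ :=
  summable_gauss hτ _ (c * _) _ fun n => by
    rw [thB_eq, ← mul_assoc, norm_mul, norm_mul, norm_mul, norm_mul]; simp; rfl
lemma im2 {τ : ℂ} (hτ : 0 < τ.im) : 0 < (2 * τ).im := by simpa using hτ
lemma sE {τ : ℂ} (hτ : 0 < τ.im) (z c : ℂ) : Summable fun n => ‖c * thE n z τ‖ :=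
  summable_gauss (im2 hτ) _ (c * _) _ fun n => by rw [thE_eq, ← mul_assoc, norm_mul]

def Th3 (z τ : ℂ) : ℂ := ∑' n, thA n z (2 * τ)
def Th2 (z τ : ℂ) : ℂ := ∑' n, thB n z (2 * τ)
def ThE (z τ : ℂ) : ℂ := ∑' n, thE n z τ

lemma theta4_eq (z τ : ℂ) : theta4 z τ = ∑' n : ℤ, 1 * (-1) ^ n * thA n z τ := by
  simp [theta4, thA]
lemma theta1_eq (z τ : ℂ) : theta1 z τ = ∑' n : ℤ, (-I) * (-1) ^ n * thB n z τ := by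
  simp [theta1, thB]

lemma sgn_par (j l : ℤ) : (-1 : ℂ) ^ (j + l) * (-1) ^ (j - l) = 1 := by
  rw [← zpow_add₀ (by norm_num), show j + l + (j - l) = 2 * j by ring, _root_.zpow_mul]; simp
lemma sgn_par' (j l : ℤ) : (-1 : ℂ) ^ (j + l + 1) * (-1) ^ (j - l) = -1 := by
  rw [zpow_add_one₀ (by norm_num), mul_right_comm, sgn_par, one_mul]
lemma sgn_neg (n : ℤ) : (-1 : ℂ) ^ (-n) = (-1) ^ n := by
  rw [_root_.zpow_neg, ← _root_.inv_zpow, show (-1 : ℂ)⁻¹ = -1 by norm_num]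

lemma theta44 {τ : ℂ} (hτ : 0 < τ.im) (x y : ℂ) : theta4 x τ * theta4 y τ =
    Th3 (x + y) τ * Th3 (x - y) τ - Th2 (x + y) τ * Th2 (x - y) τ := by
  rw [theta4_eq, theta4_eq]
  have := tsum_par _ _ (fun n => 1 * thA n (x + y) (2 * τ)) (fun n => 1 * thA n (x - y) (2 * τ))
    (fun n => (-1) * thB n (x + y) (2 * τ)) (fun n => 1 * thB n (x - y) (2 * τ))
    (sA' hτ x 1) (sA' hτ y 1) (sA (im2 hτ) _ _) (sA (im2 hτ) _ _) (sB (im2 hτ) _ _)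
    (sB (im2 hτ) _ _) ?_ ?_
  · rw [this]
    simp only [Th3, Th2, one_mul, neg_mul, tsum_neg]
    ring
  · intro j l
    calc _ = ((-1) ^ (j + l) * (-1) ^ (j - l)) * (thA (j + l) x τ * thA (j - l) y τ) := by ring
      _ = _ := by
        rw [sgn_par]
        simp only [thA, one_mul, ← Complex.exp_add]
        congr 1; push_cast; ring
  · intro j l
    calc _ = ((-1) ^ (j + l + 1) * (-1) ^ (j - l)) * (thA (j + l + 1) x τ * thA (j - l) y τ) := by
            ring
      _ = _ := by
        rw [sgn_par']
        simp only [thA, thB, one_mul, neg_mul, ← Complex.exp_add]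
        congr 2; push_cast; ring

lemma theta11 {τ : ℂ} (hτ : 0 < τ.im) (x y : ℂ) : theta1 x τ * theta1 y τ =
    Th3 (x + y) τ * Th2 (x - y) τ - Th2 (x + y) τ * Th3 (x - y) τ := by
  rw [theta1_eq, theta1_eq]
  have := tsum_par _ _ (fun n => (-1) * thB n (x + y) (2 * τ)) (fun n => 1 * thA n (x - y) (2 * τ))
    (fun n => 1 * thA (n + 1) (x + y) (2 * τ)) (fun n => 1 * thB n (x - y) (2 * τ))
    (sB' hτ x (-I)) (sB' hτ y (-I)) (sB (im2 hτ) _ _) (sA (im2 hτ) _ _)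
    ((Equiv.addRight (1 : ℤ)).summable_iff.2 (sA (im2 hτ) (x + y) 1))
    (sB (im2 hτ) _ _) ?_ ?_
  · rw [this]
    simp only [Th3, Th2, one_mul, neg_mul, tsum_neg]
    rw [show ∑' n : ℤ, thA (n + 1) (x + y) (2 * τ) = ∑' n : ℤ, thA n (x + y) (2 * τ) from
      (Equiv.addRight (1 : ℤ)).tsum_eq (fun n => thA n (x + y) (2 * τ))]
    ring
  · intro j l
    calc _ = (I * I) * ((-1) ^ (j + l) * (-1) ^ (j - l)) *
          (thB (j + l) x τ * thB (j - l) y τ) := by ring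
      _ = _ := by
        rw [sgn_par, I_mul_I]
        simp only [thA, thB, one_mul, mul_one, neg_mul, ← Complex.exp_add]
        congr 2; push_cast; ring
  · intro j l
    calc _ = (I * I) * ((-1) ^ (j + l + 1) * (-1) ^ (j - l)) *
          (thB (j + l + 1) x τ * thB (j - l) y τ) := by ring
      _ = _ := by
        rw [sgn_par', I_mul_I]
        simp only [thA, thB, one_mul, mul_one, neg_mul, neg_neg, ← Complex.exp_add]
        congr 1; push_cast; ring

lemma ThO (z τ : ℂ) : ∑' n : ℤ,
    cexp ((Real.pi : ℂ) * I * (2 * (n : ℂ) + 3 / 2) ^ 2 * (τ / 2) + (4 * (n : ℂ) + 3) * I * z) =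
    ThE (-z) τ := by
  rw [ThE, ← (Equiv.subLeft (-1 : ℤ)).tsum_eq]
  congr 1; funext n
  simp only [thE, Equiv.subLeft_apply]
  congr 1; push_cast; ring

lemma theta14 {τ : ℂ} (hτ : 0 < τ.im) (x y : ℂ) : theta1 x τ * theta4 y τ =
    -I * (ThE ((x + y) / 2) τ * ThE ((x - y) / 2) τ
      - ThE (-((x + y) / 2)) τ * ThE (-((x - y) / 2)) τ) := by
  rw [theta1_eq, theta4_eq]
  have key : ∀ z c : ℂ, Summable fun n : ℤ =>
      ‖c * thE (Equiv.subLeft (-1 : ℤ) n) (-z) τ‖ := fun z c =>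
    ((Equiv.subLeft (-1 : ℤ)).summable_iff (f := fun n => ‖c * thE n (-z) τ‖)).2 (sE hτ (-z) c)
  have := tsum_par _ _ (fun n => (-I) * thE n ((x + y) / 2) τ) (fun n => 1 * thE n ((x - y) / 2) τ)
    (fun n => I * thE (Equiv.subLeft (-1 : ℤ) n) (-((x + y) / 2)) τ)
    (fun n => 1 * thE (Equiv.subLeft (-1 : ℤ) n) (-((x - y) / 2)) τ)
    (sB' hτ x (-I)) (sA' hτ y 1) (sE hτ _ _) (sE hτ _ _) (key _ _) (key _ _) ?_ ?_
  · rw [this]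
    simp only [tsum_mul_left]
    rw [(Equiv.subLeft (-1 : ℤ)).tsum_eq (fun n => thE n (-((x + y) / 2)) τ),
      (Equiv.subLeft (-1 : ℤ)).tsum_eq (fun n => thE n (-((x - y) / 2)) τ)]
    simp only [ThE]
    ring
  · intro j l
    calc _ = (-I) * ((-1) ^ (j + l) * (-1) ^ (j - l)) *
          (thB (j + l) x τ * thA (j - l) y τ) := by ring
      _ = _ := by
        rw [sgn_par, one_mul, mul_one, mul_assoc]
        simp only [thA, thB, thE, ← Complex.exp_add]
        congr 2; push_cast; ring
  · intro j l
    calc _ = (-I) * ((-1) ^ (j + l + 1) * (-1) ^ (j - l)) *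
          (thB (j + l + 1) x τ * thA (j - l) y τ) := by ring
      _ = _ := by
        rw [sgn_par', one_mul, mul_neg_one, neg_neg, mul_assoc]
        simp only [thA, thB, thE, Equiv.subLeft_apply, ← Complex.exp_add]
        congr 2; push_cast; ring

lemma wron {τ : ℂ} (hτ : 0 < τ.im) (x y : ℂ) :
    theta1 x τ * theta4 y τ - theta4 x τ * theta1 y τ =
    -I * (ThE ((x + y) / 2) τ + ThE (-((x + y) / 2)) τ) *
      (ThE ((x - y) / 2) τ - ThE (-((x - y) / 2)) τ) := by
  rw [theta14 hτ, mul_comm (theta4 x τ), theta14 hτ, add_comm y x,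
    show (y - x) / 2 = -((x - y) / 2) by ring, neg_neg]
  ring

lemma Th3_neg (z τ : ℂ) : Th3 (-z) τ = Th3 z τ := by
  rw [Th3, Th3, ← (Equiv.neg ℤ).tsum_eq]
  congr 1; funext n
  simp only [thA, Equiv.neg_apply]
  congr 1; push_cast; ring
lemma Th2_neg (z τ : ℂ) : Th2 (-z) τ = Th2 z τ := by
  rw [Th2, Th2, ← (Equiv.subLeft (-1 : ℤ)).tsum_eq]
  congr 1; funext n
  simp only [thB, Equiv.subLeft_apply]
  congr 1; push_cast; ring
lemma theta4_neg (z τ : ℂ) : theta4 (-z) τ = theta4 z τ := by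
  rw [theta4_eq, theta4_eq, ← (Equiv.neg ℤ).tsum_eq]
  congr 1; funext n
  simp only [thA, Equiv.neg_apply, sgn_neg]
  congr 2; push_cast; ring
lemma theta1_neg (z τ : ℂ) : theta1 (-z) τ = -theta1 z τ := by
  rw [theta1_eq, theta1_eq, ← (Equiv.subLeft (-1 : ℤ)).tsum_eq, ← tsum_neg]
  congr 1; funext n
  simp only [thB, Equiv.subLeft_apply]
  rw [show (-1 : ℂ) ^ (-1 - n) = - (-1) ^ n by
    rw [show -1 - n = -(n + 1) by ring, sgn_neg, zpow_add_one₀ (by norm_num)]; ring]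
  rw [mul_neg, neg_mul]
  congr 3; push_cast; ring

/-- basic identities -/
lemma J1 {τ : ℂ} (hτ : 0 < τ.im) (a b c d : ℂ) (h : a + b = c + d) :
    theta4 a τ * theta4 b τ * (theta1 c τ * theta1 d τ)
      - theta1 a τ * theta1 b τ * (theta4 c τ * theta4 d τ)
    = theta4 0 τ * theta4 (a + b) τ * (theta1 (c - a) τ * theta1 (d - a) τ) := by
  rw [theta44 hτ a b, theta44 hτ c d, theta11 hτ a b, theta11 hτ c d, theta44 hτ 0 (a + b),
    theta11 hτ (c - a) (d - a), ← h]
  rw [show 0 + (a + b) = a + b by ring, show 0 - (a + b) = -(a + b) by ring,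
    show c - a - (d - a) = c - d by ring, show c - a + (d - a) = -(a - b) by linear_combination -h,
    Th3_neg, Th2_neg, Th3_neg, Th2_neg]
  ring

lemma J2 {τ : ℂ} (hτ : 0 < τ.im) (a b c d : ℂ) (h : a + b = c + d) :
    theta4 a τ * theta4 b τ * (theta4 c τ * theta4 d τ)
      - theta1 a τ * theta1 b τ * (theta1 c τ * theta1 d τ)
    = theta4 0 τ * theta4 (a + b) τ * (theta4 (c - a) τ * theta4 (d - a) τ) := by
  rw [theta44 hτ a b, theta44 hτ c d, theta11 hτ a b, theta11 hτ c d, theta44 hτ 0 (a + b),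
    theta44 hτ (c - a) (d - a), ← h]
  rw [show 0 + (a + b) = a + b by ring, show 0 - (a + b) = -(a + b) by ring,
    show c - a - (d - a) = c - d by ring, show c - a + (d - a) = -(a - b) by linear_combination -h,
    Th3_neg, Th2_neg, Th3_neg, Th2_neg]
  ring

lemma jt_ne_zero {τ : ℂ} (hτ : 0 < τ.im) : ∃ z, jacobiTheta₂ z τ ≠ 0 := by
  by_contra hcon
  push Not at hcon
  let f : ℤ → C(ℝ, ℂ) := fun n => ⟨fun x => jacobiTheta₂_term n x τ, by
    unfold jacobiTheta₂_term; fun_prop⟩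
  have hnorm : ∀ n (x : ℝ), ‖f n x‖ = ‖jacobiTheta₂_term n 0 τ‖ := by
    intro n x
    simp [f, norm_jacobiTheta₂_term]
  have h := intervalIntegral.hasSum_intervalIntegral_of_summable_norm (f := f) (a := 0) (b := 1) ?_
  · have h0 : ∀ x : ℝ, ∑' n, f n x = 0 := fun x => hcon x
    simp only [h0, intervalIntegral.integral_zero] at h
    have h1 : ∀ n : ℤ, n ≠ 0 → ∫ x in (0 : ℝ)..1, f n x = 0 := by
      intro n hn
      have hc : (2 * Real.pi * I * n : ℂ) ≠ 0 := by
        have := pi_ne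
        simp [hn, Real.pi_ne_zero]
      have : ∀ x : ℝ, f n x = cexp (Real.pi * I * n ^ 2 * τ) * cexp (2 * Real.pi * I * n * x) := by
        intro x
        simp only [f, ContinuousMap.coe_mk, jacobiTheta₂_term]
        rw [Complex.exp_add, mul_comm]
      simp only [this, intervalIntegral.integral_const_mul, integral_exp_mul_complex hc]
      rw [show (2 * Real.pi * I * n * ((1 : ℝ) : ℂ) : ℂ) = n * (2 * Real.pi * I) by push_cast; ring,
        Complex.exp_int_mul_two_pi_mul_I]
      simp
    have h2 : ∫ x in (0 : ℝ)..1, f 0 x = 1 := by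
      simp [f, jacobiTheta₂_term]
    have h3 := hasSum_single (f := fun n => ∫ x in (0 : ℝ)..1, f n x) 0 (fun n hn => h1 n hn)
    have := h.unique h3
    rw [h2] at this
    exact zero_ne_one this
  · refine Summable.of_nonneg_of_le (fun _ => norm_nonneg _) (fun n => ?_)
      (((summable_jacobiTheta₂_term_iff 0 τ).2 hτ).norm)
    rw [ContinuousMap.norm_le _ (norm_nonneg _)]
    intro x
    exact (hnorm n x).le

lemma sgn_exp (n : ℤ) : (-1 : ℂ) ^ n = cexp (Real.pi * I * n) := by
  rw [mul_comm, Complex.exp_int_mul, Complex.exp_pi_mul_I]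

lemma theta4_jt (z τ : ℂ) : theta4 z τ = jacobiTheta₂ (z / Real.pi + 1 / 2) τ := by
  rw [theta4_eq, jacobiTheta₂]
  congr 1; funext n
  rw [thA_eq, sgn_exp, one_mul, jacobiTheta₂_term, jacobiTheta₂_term, ← Complex.exp_add]
  congr 1; ring

lemma theta1_jt (z τ : ℂ) : theta1 z τ = -I * cexp ((Real.pi : ℂ) * I * τ / 4 + I * z) *
    jacobiTheta₂ (z / Real.pi + τ / 2 + 1 / 2) τ := by
  rw [theta1_eq, jacobiTheta₂, ← tsum_mul_left]
  congr 1; funext n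
  rw [thB_eq, sgn_exp, jacobiTheta₂_term, jacobiTheta₂_term]
  simp only [mul_assoc, ← Complex.exp_add]
  congr 2; ring

lemma Th3_jt (z τ : ℂ) : Th3 z τ = jacobiTheta₂ (z / Real.pi) (2 * τ) := by
  simp [Th3, jacobiTheta₂, thA_eq]

lemma Th2_jt (z τ : ℂ) : Th2 z τ = cexp ((Real.pi : ℂ) * I * (2 * τ) / 4 + I * z) *
    jacobiTheta₂ (z / Real.pi + (2 * τ) / 2) (2 * τ) := by
  simp only [Th2, jacobiTheta₂, thB_eq, tsum_mul_left]

lemma jt_diff {τ : ℂ} (hτ : 0 < τ.im) : Differentiable ℂ (fun z => jacobiTheta₂ z τ) :=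
  fun z => differentiableAt_jacobiTheta₂_fst z hτ

lemma theta4_diff {τ : ℂ} (hτ : 0 < τ.im) : Differentiable ℂ (fun z => theta4 z τ) := by
  simp only [theta4_jt]
  exact (jt_diff hτ).comp (by fun_prop : Differentiable ℂ fun z : ℂ => z / Real.pi + 1 / 2)
lemma theta1_diff {τ : ℂ} (hτ : 0 < τ.im) : Differentiable ℂ (fun z => theta1 z τ) := by
  simp only [theta1_jt]
  have := (jt_diff hτ).comp (by fun_prop : Differentiable ℂ fun z : ℂ => z / Real.pi + τ / 2 + 1 / 2)
  exact Differentiable.mul (by fun_prop) this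
lemma Th3_diff {τ : ℂ} (hτ : 0 < τ.im) : Differentiable ℂ (fun z => Th3 z τ) := by
  simp only [Th3_jt]
  exact (jt_diff (im2 hτ)).comp (by fun_prop : Differentiable ℂ fun z : ℂ => z / Real.pi)
lemma Th2_diff {τ : ℂ} (hτ : 0 < τ.im) : Differentiable ℂ (fun z => Th2 z τ) := by
  simp only [Th2_jt]
  have := (jt_diff (im2 hτ)).comp
    (by fun_prop : Differentiable ℂ fun z : ℂ => z / Real.pi + (2 * τ) / 2)
  exact Differentiable.mul (by fun_prop) this

lemma anal {f : ℂ → ℂ} (hf : Differentiable ℂ f) : AnalyticOnNhd ℂ f Set.univ :=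
  fun z _ => hf.analyticAt z

lemma mul_zero_or {f g : ℂ → ℂ} (hf : Differentiable ℂ f) (hg : Differentiable ℂ g)
    (h : ∀ z, f z * g z = 0) : (∀ z, f z = 0) ∨ (∀ z, g z = 0) := by
  simpa using AnalyticOnNhd.eq_zero_or_eq_zero_of_mul_eq_zero (anal hf) (anal hg)
    (fun z _ => h z) isPreconnected_univ

lemma Th3_add (z τ : ℂ) : Th3 (z + Real.pi) τ = Th3 z τ := by
  rw [Th3_jt, Th3_jt, add_div, div_self pi_ne, jacobiTheta₂_add_left]
lemma Th2_add (z τ : ℂ) : Th2 (z + Real.pi) τ = -Th2 z τ := by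
  rw [Th2_jt, Th2_jt, add_div, div_self pi_ne, add_right_comm, jacobiTheta₂_add_left, mul_add,
    ← add_assoc, Complex.exp_add, mul_comm I (Real.pi : ℂ), Complex.exp_pi_mul_I]
  ring

lemma Th3_ne {τ : ℂ} (hτ : 0 < τ.im) : ¬ ∀ z, Th3 z τ = 0 := by
  obtain ⟨z, hz⟩ := jt_ne_zero (im2 hτ)
  intro h
  apply hz
  have := h (z * Real.pi)
  rwa [Th3_jt, mul_div_cancel_right₀ _ pi_ne] at this

lemma theta40_ne {τ : ℂ} (hτ : 0 < τ.im) : theta4 0 τ ≠ 0 := by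
  intro h0
  have h : ∀ z, (Th3 z τ - Th2 z τ) * (Th3 z τ + Th2 z τ) = 0 := by
    intro z
    have := theta44 hτ 0 z
    rw [h0, zero_mul, zero_add, zero_sub, Th3_neg, Th2_neg] at this
    linear_combination -this
  rcases mul_zero_or ((Th3_diff hτ).sub (Th2_diff hτ)) ((Th3_diff hτ).add (Th2_diff hτ)) h
    with h | h <;>
  · apply Th3_ne hτ
    intro z
    have h1 := h z
    have h2 := h (z + Real.pi)
    simp only [Pi.sub_apply, Pi.add_apply] at h1 h2
    rw [Th3_add, Th2_add] at h2
    linear_combination (h1 + h2) / 2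

lemma theta4_ne {τ : ℂ} (hτ : 0 < τ.im) : ¬ ∀ z, theta4 z τ = 0 := fun h => theta40_ne hτ (h 0)
lemma theta1_ne {τ : ℂ} (hτ : 0 < τ.im) : ¬ ∀ z, theta1 z τ = 0 := by
  obtain ⟨z, hz⟩ := jt_ne_zero hτ
  intro h
  apply hz
  have := h ((z - τ / 2 - 1 / 2) * Real.pi)
  rw [theta1_jt, mul_div_cancel_right₀ _ pi_ne, mul_eq_zero] at this
  rcases this with h | h
  · simp [Complex.exp_ne_zero] at h
  · rwa [show z - τ / 2 - 1 / 2 + τ / 2 + 1 / 2 = z by ring] at h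

/-- density of the nonvanishing set -/
lemma theta_freq {τ : ℂ} (hτ : 0 < τ.im) (p q : ℂ) (hp : p ≠ 0) (x : ℂ) :
    ∀ᶠ z in nhdsWithin x {x}ᶜ, theta1 (p * z + q) τ * theta4 (p * z + q) τ ≠ 0 := by
  have d1 : Differentiable ℂ (fun z => theta1 (p * z + q) τ) :=
    (theta1_diff hτ).comp (by fun_prop : Differentiable ℂ fun z : ℂ => p * z + q)
  have d4 : Differentiable ℂ (fun z => theta4 (p * z + q) τ) :=
    (theta4_diff hτ).comp (by fun_prop : Differentiable ℂ fun z : ℂ => p * z + q)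
  have d := d1.mul d4
  rcases (d.analyticAt x).eventually_eq_zero_or_eventually_ne_zero with h | h
  · exfalso
    have h' := (anal d).eqOn_zero_of_preconnected_of_eventuallyEq_zero isPreconnected_univ
      (Set.mem_univ x) h
    have back : ∀ w, p * ((w - q) / p) + q = w := fun w => by field_simp; ring
    rcases mul_zero_or d1 d4 (fun z => h' (Set.mem_univ z)) with h | h
    · exact theta1_ne hτ fun w => by simpa [back] using h ((w - q) / p)
    · exact theta4_ne hτ fun w => by simpa [back] using h ((w - q) / p)
  · exact h

set_option linter.unusedSimpArgs false

lemma HJ_neg (K K' z : ℂ) : HJ K K' (-z) = -HJ K K' z := by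
  rw [HJ, HJ, mul_neg, neg_div, theta1_neg]
lemma ΘJ_neg (K K' z : ℂ) : ΘJ K K' (-z) = ΘJ K K' z := by
  rw [ΘJ, ΘJ, mul_neg, neg_div, theta4_neg]

lemma JH1 {K K' : ℂ} (hτ : 0 < (I * K' / K).im) (a b c d e f g : ℂ) (h : a + b = c + d)
    (he : e = c - a) (hf : f = d - a) (hg : g = a + b) :
    ΘJ K K' a * ΘJ K K' b * (HJ K K' c * HJ K K' d)
      - HJ K K' a * HJ K K' b * (ΘJ K K' c * ΘJ K K' d)
    = ΘJ K K' 0 * ΘJ K K' g * (HJ K K' e * HJ K K' f) := by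
  subst he hf hg
  have := J1 hτ (Real.pi * a / (2 * K)) (Real.pi * b / (2 * K)) (Real.pi * c / (2 * K))
    (Real.pi * d / (2 * K)) (by rw [← add_div, ← add_div, ← mul_add, ← mul_add, h])
  rw [← sub_div, ← sub_div, ← mul_sub, ← mul_sub, ← add_div, ← mul_add] at this
  simpa [HJ, ΘJ] using this

lemma JH2 {K K' : ℂ} (hτ : 0 < (I * K' / K).im) (a b c d e f g : ℂ) (h : a + b = c + d)
    (he : e = c - a) (hf : f = d - a) (hg : g = a + b) :
    ΘJ K K' a * ΘJ K K' b * (ΘJ K K' c * ΘJ K K' d)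
      - HJ K K' a * HJ K K' b * (HJ K K' c * HJ K K' d)
    = ΘJ K K' 0 * ΘJ K K' g * (ΘJ K K' e * ΘJ K K' f) := by
  subst he hf hg
  have := J2 hτ (Real.pi * a / (2 * K)) (Real.pi * b / (2 * K)) (Real.pi * c / (2 * K))
    (Real.pi * d / (2 * K)) (by rw [← add_div, ← add_div, ← mul_add, ← mul_add, h])
  rw [← sub_div, ← sub_div, ← mul_sub, ← mul_sub, ← add_div, ← mul_add] at this
  simpa [HJ, ΘJ] using this

lemma ybe_scalar {K K' : ℂ} (hτ : 0 < (I * K' / K).im) (η lam mu : ℂ)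
    {a b c d a1 b1 c1 d1 a2 b2 c2 d2 : ℂ}
    (ha : a = aJ K K' η lam mu) (hb : b = bJ K K' η lam mu) (hc : c = cJ K K' η lam mu)
    (hd : d = dJ K K' η lam mu) (ha1 : a1 = w4p3 K K' η lam) (hb1 : b1 = w1p2 K K' η lam)
    (hc1 : c1 = w4m3 K K' η lam) (hd1 : d1 = w1m2 K K' η lam) (ha2 : a2 = w4p3 K K' η mu)
    (hb2 : b2 = w1p2 K K' η mu) (hc2 : c2 = w4m3 K K' η mu) (hd2 : d2 = w1m2 K K' η mu) :
    a*b1*a2 - b*a1*b2 - c*b1*c2 + d*a1*d2 = 0 ∧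
    a*d1*c2 - b*c1*d2 - c*d1*a2 + d*c1*b2 = 0 ∧
    -(a*b1*d2) + a*d1*b2 - d*a1*a2 + d*c1*c2 = 0 ∧
    a*c1*b2 - b*b1*c2 - c*a1*b2 + d*d1*c2 = 0 ∧
    b*a1*c2 - b*c1*a2 + c*b1*b2 - c*d1*d2 = 0 ∧
    a*a1*d2 - b*d1*a2 - c*c1*d2 + d*b1*a2 = 0 := by
  obtain ⟨u, hu⟩ : ∃ u, u = lam - mu := ⟨_, rfl⟩
  obtain ⟨U, hU⟩ : ∃ u, u = lam - mu + 2 * η := ⟨_, rfl⟩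
  obtain ⟨x, hx⟩ : ∃ u, u = lam - η := ⟨_, rfl⟩
  obtain ⟨X, hX⟩ : ∃ u, u = lam + η := ⟨_, rfl⟩
  obtain ⟨y, hy⟩ : ∃ u, u = mu - η := ⟨_, rfl⟩
  obtain ⟨Y, hY⟩ : ∃ u, u = mu + η := ⟨_, rfl⟩
  obtain ⟨w, hw⟩ : ∃ u, u = 2 * η := ⟨_, rfl⟩
  have hU' : u + w = U := by rw [hu, hw, hU]
  simp only [aJ, bJ, cJ, dJ, w4p3, w4m3, w1p2, w1m2, ← hu, ← hw, hU', ← hx, ← hX, ← hy, ← hY]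
    at ha hb hc hd ha1 hb1 hc1 hd1 ha2 hb2 hc2 hd2
  have A1 := JH1 hτ w X U Y u y (w + X) (by simp only [hu, hU, hx, hX, hy, hY, hw]; ring) (by simp only [hu, hU, hx, hX, hy, hY, hw]; ring) (by simp only [hu, hU, hx, hX, hy, hY, hw]; ring) rfl
  have A2 := JH2 hτ w X U Y u y (w + X) (by simp only [hu, hU, hx, hX, hy, hY, hw]; ring) (by simp only [hu, hU, hx, hX, hy, hY, hw]; ring) (by simp only [hu, hU, hx, hX, hy, hY, hw]; ring) rfl
  have B1 := JH1 hτ w (-Y) U (-X) u (-(X + w)) (-y) (by simp only [hu, hU, hx, hX, hy, hY, hw]; ring) (by simp only [hu, hU, hx, hX, hy, hY, hw]; ring) (by simp only [hu, hU, hx, hX, hy, hY, hw]; ring) (by simp only [hu, hU, hx, hX, hy, hY, hw]; ring)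
  have B2 := JH1 hτ w (-U) Y (-X) y (-(X + w)) (-u) (by simp only [hu, hU, hx, hX, hy, hY, hw]; ring) (by simp only [hu, hU, hx, hX, hy, hY, hw]; ring) (by simp only [hu, hU, hx, hX, hy, hY, hw]; ring) (by simp only [hu, hU, hx, hX, hy, hY, hw]; ring)
  have C1 := JH1 hτ y (-Y) x (-X) u (-(X + y)) (-w) (by simp only [hu, hU, hx, hX, hy, hY, hw]; ring) (by simp only [hu, hU, hx, hX, hy, hY, hw]; ring) (by simp only [hu, hU, hx, hX, hy, hY, hw]; ring) (by simp only [hu, hU, hx, hX, hy, hY, hw]; ring)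
  have C2 := JH1 hτ x (-y) X (-Y) w (-(X + y)) u (by simp only [hu, hU, hx, hX, hy, hY, hw]; ring) (by simp only [hu, hU, hx, hX, hy, hY, hw]; ring) (by simp only [hu, hU, hx, hX, hy, hY, hw]; ring) (by simp only [hu, hU, hx, hX, hy, hY, hw]; ring)
  have D1 := JH1 hτ u X U x w y (u + X) (by simp only [hu, hU, hx, hX, hy, hY, hw]; ring) (by simp only [hu, hU, hx, hX, hy, hY, hw]; ring) (by simp only [hu, hU, hx, hX, hy, hY, hw]; ring) rfl
  have D2 := JH2 hτ u X U x w y (u + X) (by simp only [hu, hU, hx, hX, hy, hY, hw]; ring) (by simp only [hu, hU, hx, hX, hy, hY, hw]; ring) (by simp only [hu, hU, hx, hX, hy, hY, hw]; ring) rfl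
  have E1 := JH1 hτ x Y X y w (-u) (x + Y) (by simp only [hu, hU, hx, hX, hy, hY, hw]; ring) (by simp only [hu, hU, hx, hX, hy, hY, hw]; ring) (by simp only [hu, hU, hx, hX, hy, hY, hw]; ring) rfl
  have E2 := JH2 hτ x Y X y w (-u) (x + Y) (by simp only [hu, hU, hx, hX, hy, hY, hw]; ring) (by simp only [hu, hU, hx, hX, hy, hY, hw]; ring) (by simp only [hu, hU, hx, hX, hy, hY, hw]; ring) rfl
  have F1 := JH1 hτ u (-x) U (-X) w (-(X + u)) (-y) (by simp only [hu, hU, hx, hX, hy, hY, hw]; ring) (by simp only [hu, hU, hx, hX, hy, hY, hw]; ring) (by simp only [hu, hU, hx, hX, hy, hY, hw]; ring) (by simp only [hu, hU, hx, hX, hy, hY, hw]; ring)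
  have F2 := JH1 hτ u (-U) x (-X) y (-(X + u)) (-w) (by simp only [hu, hU, hx, hX, hy, hY, hw]; ring) (by simp only [hu, hU, hx, hX, hy, hY, hw]; ring) (by simp only [hu, hU, hx, hX, hy, hY, hw]; ring) (by simp only [hu, hU, hx, hX, hy, hY, hw]; ring)
  simp only [HJ_neg, ΘJ_neg] at A1 A2 B1 B2 C1 C2 D1 D2 E1 E2 F1 F2
  clear hU' hu hU hx hX hy hY hw
  generalize ΘJ K K' u = Tu at *
  generalize ΘJ K K' U = TU at *
  generalize ΘJ K K' x = Tx at *
  generalize ΘJ K K' X = TX at *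
  generalize ΘJ K K' y = Ty at *
  generalize ΘJ K K' Y = TY at *
  generalize ΘJ K K' w = Tw at *
  generalize HJ K K' u = hu at *
  generalize HJ K K' U = hU at *
  generalize HJ K K' x = hx at *
  generalize HJ K K' X = hX at *
  generalize HJ K K' y = hy at *
  generalize HJ K K' Y = hY at *
  generalize HJ K K' w = hw at *
  subst ha hb hc hd ha1 hb1 hc1 hd1 ha2 hb2 hc2 hd2
  refine ⟨?_, ?_, ?_, ?_, ?_, ?_⟩
  · linear_combination Tw * hw * Tx * (Tu * Ty * A1 - hu * hy * A2)
  · linear_combination Tw * hw * hx * (-Tu * hy * B1 + hu * Ty * B2)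
  · linear_combination hU * hw * Tw * (-hw * Tu * C1 + Tw * hu * C2)
  · linear_combination Tw * hw * TY * (Tw * Ty * D1 - hw * hy * D2)
  · linear_combination Tw * hw * TU * (Tw * Tu * E1 + hw * hu * E2)
  · linear_combination Tw * hw * hY * (-Tw * hy * F1 + hw * Ty * F2)

/-- intertwining vectors -/
lemma irf {K K' : ℂ} (hτ : 0 < (I * K' / K).im) (η lam mu p q : ℂ) (hpq : p - q = lam - mu) :
    (aJ K K' η lam mu * (HJ K K' (p + 2 * η) * HJ K K' q)
      + dJ K K' η lam mu * (ΘJ K K' (p + 2 * η) * ΘJ K K' q)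
      = hJ K K' (lam - mu + 2 * η) * (HJ K K' (q + 2 * η) * HJ K K' p)) ∧
    (dJ K K' η lam mu * (HJ K K' (p + 2 * η) * HJ K K' q)
      + aJ K K' η lam mu * (ΘJ K K' (p + 2 * η) * ΘJ K K' q)
      = hJ K K' (lam - mu + 2 * η) * (ΘJ K K' (q + 2 * η) * ΘJ K K' p)) ∧
    (bJ K K' η lam mu * (HJ K K' (p + 2 * η) * ΘJ K K' q)
      + cJ K K' η lam mu * (ΘJ K K' (p + 2 * η) * HJ K K' q)
      = hJ K K' (lam - mu + 2 * η) * (HJ K K' (q + 2 * η) * ΘJ K K' p)) ∧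
    (cJ K K' η lam mu * (HJ K K' (p + 2 * η) * ΘJ K K' q)
      + bJ K K' η lam mu * (ΘJ K K' (p + 2 * η) * HJ K K' q)
      = hJ K K' (lam - mu + 2 * η) * (ΘJ K K' (q + 2 * η) * HJ K K' p)) := by
  simp only [aJ, bJ, cJ, dJ, hJ, gJ]
  obtain ⟨u, hu⟩ : ∃ u, u = lam - mu := ⟨_, rfl⟩
  rw [← hu] at hpq ⊢
  obtain rfl : p = q + u := by rw [← hpq]; ring
  clear hpq
  obtain ⟨w, hw⟩ : ∃ u, u = 2 * η := ⟨_, rfl⟩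
  rw [← hw]
  have A1 := JH1 hτ w u (q + u + w) (-q) (q + u) (-(q + w)) (u + w) (by ring) (by ring) (by ring) (by ring)
  have A2 := JH2 hτ w u (q + u + w) (-q) (q + u) (-(q + w)) (u + w) (by ring) (by ring) (by ring) (by ring)
  have A3 := JH1 hτ u q (q + u + w) (-w) (q + w) (-(u + w)) (q + u) (by ring) (by ring) (by ring) (by ring)
  have A4 := JH1 hτ w q (q + u + w) (-u) (q + u) (-(u + w)) (q + w) (by ring) (by ring) (by ring) (by ring)
  simp only [HJ_neg, ΘJ_neg] at A1 A2 A3 A4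
  refine ⟨?_, ?_, ?_, ?_⟩
  · linear_combination -HJ K K' (u + w) * A1
  · linear_combination HJ K K' (u + w) * A2
  · linear_combination -ΘJ K K' (u + w) * A3
  · linear_combination -ΘJ K K' (u + w) * A4

def piTen (L : ℕ) (A : Fin L → Matrix (Fin 2) (Fin 2) ℂ) : OpC L :=
  Matrix.of fun f g => ∏ m, A m (f m) (g m)

lemma piTen_mul (L : ℕ) (A B : Fin L → Matrix (Fin 2) (Fin 2) ℂ) :
    piTen L (A * B) = piTen L A * piTen L B := by
  ext f h
  simp only [piTen, Matrix.of_apply, Matrix.mul_apply, Pi.mul_apply]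
  rw [Finset.prod_univ_sum]
  simp [Finset.prod_mul_distrib]

lemma embed_eq (L : ℕ) (n : Fin L) (A : Matrix (Fin 2) (Fin 2) ℂ) :
    embed L n A = piTen L (Pi.mulSingle n A) := by
  ext f g
  simp only [piTen, embed, Matrix.of_apply]
  rw [← Finset.mul_prod_erase univ _ (Finset.mem_univ n), Pi.mulSingle_eq_same]
  congr 1
  apply Finset.prod_congr rfl
  intro m hm
  rw [Pi.mulSingle_eq_of_ne (Finset.ne_of_mem_erase hm), Matrix.one_apply]

lemma embed_mul (L : ℕ) (n : Fin L) (A B : Matrix (Fin 2) (Fin 2) ℂ) :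
    embed L n (A * B) = embed L n A * embed L n B := by
  rw [embed_eq, embed_eq, embed_eq, Pi.mulSingle_mul, piTen_mul]

lemma embed_comm (L : ℕ) (n m : Fin L) (h : n ≠ m) (A B : Matrix (Fin 2) (Fin 2) ℂ) :
    Commute (embed L n A) (embed L m B) := by
  rw [Commute, SemiconjBy, embed_eq, embed_eq, ← piTen_mul, ← piTen_mul]
  have := Pi.mulSingle_commute (f := fun _ : Fin L => Matrix (Fin 2) (Fin 2) ℂ) h A B
  exact congrArg (piTen L) this

lemma embed_one (L : ℕ) (n : Fin L) : embed L n 1 = 1 := by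
  rw [embed_eq, Pi.mulSingle_one]
  ext f g
  simp only [piTen, Matrix.of_apply, Pi.one_apply, Matrix.one_apply]
  rw [Finset.prod_ite_zero]
  simp [funext_iff]

def embedHom (L : ℕ) (n : Fin L) : Matrix (Fin 2) (Fin 2) ℂ →ₐ[ℂ] OpC L :=
  AlgHom.ofLinearMap
    { toFun := embed L n
      map_add' := fun A B => by
        ext f g
        simp [embed, add_mul]
      map_smul' := fun c A => by
        ext f g
        simp [embed, mul_assoc] }
    (embed_one L n) (embed_mul L n)

lemma embedHom_apply (L : ℕ) (n : Fin L) (A) : embedHom L n A = embed L n A := rfl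

section rtt
variable {A : Type*} [Ring A] [Algebra ℂ A]

def odot (T T' : Matrix (Fin 2) (Fin 2) A) : Matrix (Fin 2 × Fin 2) (Fin 2 × Fin 2) A :=
  Matrix.of fun p q => T p.1 q.1 * T' p.2 q.2

def RTT (R : Matrix (Fin 2 × Fin 2) (Fin 2 × Fin 2) ℂ) (T T' : Matrix (Fin 2) (Fin 2) A) : Prop :=
  R.map (algebraMap ℂ A) * odot T T' = odot T' T * R.map (algebraMap ℂ A)

lemma odot_mul (T T' S S' : Matrix (Fin 2) (Fin 2) A)
    (h : ∀ i j k l, Commute (S i j) (T' k l)) : odot (T * S) (T' * S') = odot T T' * odot S S' := by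
  ext ⟨i, i'⟩ ⟨j, j'⟩
  simp only [odot, Matrix.of_apply, Matrix.mul_apply, Fintype.sum_prod_type]
  rw [Finset.sum_mul_sum]
  refine Finset.sum_congr rfl fun a _ => Finset.sum_congr rfl fun b _ => ?_
  rw [mul_assoc, mul_assoc, ← mul_assoc (S a j), (h a j i' b).eq, mul_assoc]

lemma RTT_mul {R : Matrix (Fin 2 × Fin 2) (Fin 2 × Fin 2) ℂ} {T T' S S' : Matrix (Fin 2) (Fin 2) A}
    (h1 : RTT R T T') (h2 : RTT R S S') (h : ∀ i j k l, Commute (S i j) (T' k l))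
    (h' : ∀ i j k l, Commute (S' i j) (T k l)) : RTT R (T * S) (T' * S') := by
  unfold RTT at *
  rw [odot_mul _ _ _ _ h, odot_mul _ _ _ _ h', ← mul_assoc, h1, mul_assoc, h2, mul_assoc]

lemma RTT_one (R : Matrix (Fin 2 × Fin 2) (Fin 2 × Fin 2) ℂ) :
    RTT R (1 : Matrix (Fin 2) (Fin 2) A) 1 := by
  have : odot (1 : Matrix (Fin 2) (Fin 2) A) 1 = 1 := by
    ext ⟨i, i'⟩ ⟨j, j'⟩
    simp only [odot, Matrix.of_apply, Matrix.one_apply, Prod.mk.injEq]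
    split_ifs <;> simp_all
  unfold RTT
  rw [this, mul_one, one_mul]

lemma RTT_map {B : Type*} [Ring B] [Algebra ℂ B] (φ : A →ₐ[ℂ] B)
    {R : Matrix (Fin 2 × Fin 2) (Fin 2 × Fin 2) ℂ} {T T' : Matrix (Fin 2) (Fin 2) A}
    (h : RTT R T T') : RTT R (T.map φ) (T'.map φ) := by
  have e (T T' : Matrix (Fin 2) (Fin 2) A) : odot (T.map φ) (T'.map φ) = (odot T T').map φ := by
    ext i j
    simp [odot]
  have e2 : R.map (algebraMap ℂ B) = (R.map (algebraMap ℂ A)).map φ := by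
    ext i j
    simp
  unfold RTT at *
  rw [e, e, e2, ← Matrix.map_mul, ← Matrix.map_mul, h]

end rtt

lemma Lsite_eq (K K' η μ : ℂ) : Lsite K K' η μ =
    !![!![w4p3 K K' η μ, 0; 0, w4m3 K K' η μ], !![0, w1m2 K K' η μ; w1p2 K K' η μ, 0];
       !![0, w1p2 K K' η μ; w1m2 K K' η μ, 0], !![w4m3 K K' η μ, 0; 0, w4p3 K K' η μ]] := by
  ext i j a b
  fin_cases i <;> fin_cases j <;> fin_cases a <;> fin_cases b <;>
    simp [Lsite, σx, σy, σz, wc1, wc2, wc3, wc4] <;> ring_nf <;> simp <;> ring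

lemma algmap2 (z : ℂ) : algebraMap ℂ (Matrix (Fin 2) (Fin 2) ℂ) z = !![z, 0; 0, z] := by
  ext i j
  fin_cases i <;> fin_cases j <;> simp [Matrix.algebraMap_matrix_apply]

set_option maxHeartbeats 2000000 in
lemma RTT_site {K K' : ℂ} (hτ : 0 < (I * K' / K).im) (η lam mu : ℂ) :
    RTT (Rc K K' η lam mu) (Lsite K K' η lam) (Lsite K K' η mu) := by
  obtain ⟨E1, E2, E3, E4, E5, E6⟩ := ybe_scalar hτ η lam mu rfl rfl rfl rfl rfl rfl rfl rfl
    rfl rfl rfl rfl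
  unfold RTT
  rw [Lsite_eq, Lsite_eq]
  unfold Rc
  generalize aJ K K' η lam mu = a at *
  generalize bJ K K' η lam mu = b at *
  generalize cJ K K' η lam mu = c at *
  generalize dJ K K' η lam mu = d at *
  generalize w4p3 K K' η lam = a1 at *
  generalize w1p2 K K' η lam = b1 at *
  generalize w4m3 K K' η lam = c1 at *
  generalize w1m2 K K' η lam = d1 at *
  generalize w4p3 K K' η mu = a2 at *
  generalize w1p2 K K' η mu = b2 at *
  generalize w4m3 K K' η mu = c2 at *
  generalize w1m2 K K' η mu = d2 at *
  ext ⟨i, i'⟩ ⟨j, j'⟩ x y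
  fin_cases i <;> fin_cases i' <;> fin_cases j <;> fin_cases j' <;> fin_cases x <;> fin_cases y <;>
    simp [odot, Matrix.mul_apply, Fintype.sum_prod_type, algmap2] <;>
    first
    | ring1
    | linear_combination E1
    | linear_combination -E1
    | linear_combination E2
    | linear_combination -E2
    | linear_combination E3
    | linear_combination -E3
    | linear_combination E4
    | linear_combination -E4
    | linear_combination E5
    | linear_combination -E5
    | linear_combination E6
    | linear_combination -E6

lemma Lop_comm (K K' η : ℂ) (L : ℕ) (n : Fin L) (l : List (Fin L)) (h : n ∉ l) (lam mu : ℂ)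
    (i j a b : Fin 2) :
    Commute ((l.map fun m => Lop K K' η L m lam).prod i j) (Lop K K' η L n mu a b) := by
  induction l generalizing i j with
  | nil =>
    simp only [List.map_nil, List.prod_nil, Matrix.one_apply]
    split_ifs
    · exact Commute.one_left _
    · exact Commute.zero_left _
  | cons m l ih =>
    rw [List.map_cons, List.prod_cons, Matrix.mul_apply]
    refine Commute.sum_left _ _ _ fun x _ => ?_
    rw [List.mem_cons, not_or] at h
    refine Commute.mul_left ?_ (ih h.2 _ _)
    exact embed_comm L m n (Ne.symm h.1) _ _

lemma RTT_list {K K' : ℂ} (hτ : 0 < (I * K' / K).im) (η : ℂ) (L : ℕ) (lam mu : ℂ)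
    (l : List (Fin L)) (hl : l.Nodup) :
    RTT (Rc K K' η lam mu) (l.map fun m => Lop K K' η L m lam).prod
      (l.map fun m => Lop K K' η L m mu).prod := by
  induction l with
  | nil => exact RTT_one _
  | cons m l ih =>
    rw [List.nodup_cons] at hl
    simp only [List.map_cons, List.prod_cons]
    refine RTT_mul (RTT_map (embedHom L m) (RTT_site hτ η lam mu)) (ih hl.2) ?_ ?_
    · exact fun i j a b => Lop_comm K K' η L m l hl.1 lam mu i j a b
    · exact fun i j a b => Lop_comm K K' η L m l hl.1 mu lam i j a b

lemma Tm_eq (K K' η : ℂ) (L : ℕ) (mu : ℂ) :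
    Tm K K' η L mu = (((List.finRange L).map Fin.rev).map fun m => Lop K K' η L m mu).prod := by
  rw [Tm, List.ofFn_eq_map, List.map_map]
  rfl

lemma RTT_Tm {K K' : ℂ} (hτ : 0 < (I * K' / K).im) (η : ℂ) (L : ℕ) (lam mu : ℂ) :
    RTT (Rc K K' η lam mu) (Tm K K' η L lam) (Tm K K' η L mu) := by
  rw [Tm_eq, Tm_eq]
  exact RTT_list hτ η L lam mu _ ((List.nodup_finRange L).map Fin.rev_injective)

def ten (a b : Fin 2 → ℂ) : Fin 2 × Fin 2 → ℂ := fun p => a p.1 * b p.2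

section sandw
variable {A : Type*} [Ring A] [Algebra ℂ A]

def sand (Y X : Fin 2 × Fin 2 → ℂ) (M : Matrix (Fin 2 × Fin 2) (Fin 2 × Fin 2) A) : A :=
  ∑ p, ∑ q, (Y p * X q) • M p q

def bil (y x : Fin 2 → ℂ) (T : Matrix (Fin 2) (Fin 2) A) : A :=
  ∑ i, ∑ j, (y i * x j) • T i j

lemma bil_mul (y x y' x' : Fin 2 → ℂ) (T T' : Matrix (Fin 2) (Fin 2) A) :
    bil y x T * bil y' x' T' = sand (ten y y') (ten x x') (odot T T') := by
  simp only [bil, sand, ten, odot, Fintype.sum_prod_type, Fin.sum_univ_two, Matrix.of_apply,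
    add_mul, mul_add, smul_mul_assoc, mul_smul_comm]
  module

lemma sand_left (Y X : Fin 2 × Fin 2 → ℂ) (R : Matrix (Fin 2 × Fin 2) (Fin 2 × Fin 2) ℂ)
    (M : Matrix (Fin 2 × Fin 2) (Fin 2 × Fin 2) A) :
    sand Y X (R.map (algebraMap ℂ A) * M) = sand (Y ᵥ* R) X M := by
  simp only [sand, Matrix.mul_apply, Matrix.map_apply, ← Algebra.smul_def, Finset.smul_sum,
    smul_smul, Matrix.vecMul, dotProduct, Finset.sum_mul, Finset.sum_smul]
  rw [Finset.sum_comm_cycle]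
  refine Finset.sum_congr rfl fun r _ => ?_
  rw [Finset.sum_comm]
  refine Finset.sum_congr rfl fun q _ => Finset.sum_congr rfl fun p _ => ?_
  congr 1
  ring

lemma sand_right (Y X : Fin 2 × Fin 2 → ℂ) (R : Matrix (Fin 2 × Fin 2) (Fin 2 × Fin 2) ℂ)
    (M : Matrix (Fin 2 × Fin 2) (Fin 2 × Fin 2) A) :
    sand Y X (M * R.map (algebraMap ℂ A)) = sand Y (R *ᵥ X) M := by
  simp only [sand, Matrix.mul_apply, Matrix.map_apply, ← Algebra.commutes, ← Algebra.smul_def,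
    Finset.smul_sum, smul_smul, Matrix.mulVec, dotProduct, Finset.mul_sum, Finset.sum_smul]
  refine Finset.sum_congr rfl fun p _ => ?_
  rw [Finset.sum_comm]
  refine Finset.sum_congr rfl fun q _ => Finset.sum_congr rfl fun r _ => ?_
  congr 1
  ring

lemma sand_smul (h : ℂ) (Y X : Fin 2 × Fin 2 → ℂ)
    (M : Matrix (Fin 2 × Fin 2) (Fin 2 × Fin 2) A) :
    sand (h • Y) X M = h • sand Y X M ∧ sand Y (h • X) M = h • sand Y X M := by
  constructor <;>
  · simp only [sand, Pi.smul_apply, smul_eq_mul, Finset.smul_sum, smul_smul]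
    refine Finset.sum_congr rfl fun q _ => Finset.sum_congr rfl fun r _ => ?_
    congr 1
    ring

lemma key_alg {R : Matrix (Fin 2 × Fin 2) (Fin 2 × Fin 2) ℂ} {T T' : Matrix (Fin 2) (Fin 2) A}
    (hR : RTT R T T') (h : ℂ) {y1 y2 y3 y4 x1 x2 x3 x4 : Fin 2 → ℂ}
    (hy : ten y1 y2 ᵥ* R = h • ten y3 y4) (hx : R *ᵥ ten x1 x2 = h • ten x3 x4) :
    h • (bil y3 x1 T * bil y4 x2 T' - bil y1 x3 T' * bil y2 x4 T) = 0 := by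
  have := congrArg (sand (ten y1 y2) (ten x1 x2)) hR
  rw [sand_left, sand_right, hy, hx, (sand_smul _ _ _ _).1, (sand_smul _ _ _ _).2, ← bil_mul,
    ← bil_mul] at this
  rw [smul_sub, this, sub_self]

end sandw

def vJ (K K' p : ℂ) : Fin 2 → ℂ := ![HJ K K' p, ΘJ K K' p]
def zJ (K K' p : ℂ) : Fin 2 → ℂ := ![ΘJ K K' p, -HJ K K' p]

section irfs
variable {K K' : ℂ} (hτ : 0 < (I * K' / K).im) (η lam mu p q : ℂ) (hpq : p - q = lam - mu)
include hτ hpq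

lemma irfV : Rc K K' η lam mu *ᵥ ten (vJ K K' (p + 2 * η)) (vJ K K' q) =
    hJ K K' (lam - mu + 2 * η) • ten (vJ K K' (q + 2 * η)) (vJ K K' p) := by
  obtain ⟨h1, h2, h3, h4⟩ := irf hτ η lam mu p q hpq
  ext ⟨i, j⟩
  fin_cases i <;> fin_cases j <;>
    simp [Rc, ten, vJ, Matrix.mulVec, dotProduct, Fintype.sum_prod_type] <;>
    first
    | linear_combination h1
    | linear_combination h2
    | linear_combination h3
    | linear_combination h4

lemma irfV' : Rc K K' η lam mu *ᵥ ten (vJ K K' q) (vJ K K' (p + 2 * η)) =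
    hJ K K' (lam - mu + 2 * η) • ten (vJ K K' p) (vJ K K' (q + 2 * η)) := by
  obtain ⟨h1, h2, h3, h4⟩ := irf hτ η lam mu p q hpq
  ext ⟨i, j⟩
  fin_cases i <;> fin_cases j <;>
    simp [Rc, ten, vJ, Matrix.mulVec, dotProduct, Fintype.sum_prod_type] <;>
    first
    | linear_combination h1
    | linear_combination h2
    | linear_combination h3
    | linear_combination h4

lemma irfZ : ten (zJ K K' (p + 2 * η)) (zJ K K' q) ᵥ* Rc K K' η lam mu =
    hJ K K' (lam - mu + 2 * η) • ten (zJ K K' (q + 2 * η)) (zJ K K' p) := by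
  obtain ⟨h1, h2, h3, h4⟩ := irf hτ η lam mu p q hpq
  ext ⟨i, j⟩
  fin_cases i <;> fin_cases j <;>
    simp [Rc, ten, zJ, Matrix.vecMul, dotProduct, Fintype.sum_prod_type] <;>
    first
    | linear_combination h1
    | linear_combination h2
    | linear_combination h3
    | linear_combination h4
    | linear_combination -h3
    | linear_combination -h4

lemma irfZ' : ten (zJ K K' q) (zJ K K' (p + 2 * η)) ᵥ* Rc K K' η lam mu =
    hJ K K' (lam - mu + 2 * η) • ten (zJ K K' p) (zJ K K' (q + 2 * η)) := by
  obtain ⟨h1, h2, h3, h4⟩ := irf hτ η lam mu p q hpq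
  ext ⟨i, j⟩
  fin_cases i <;> fin_cases j <;>
    simp [Rc, ten, zJ, Matrix.vecMul, dotProduct, Fintype.sum_prod_type] <;>
    first
    | linear_combination h1
    | linear_combination h2
    | linear_combination h3
    | linear_combination h4
    | linear_combination -h3
    | linear_combination -h4
end irfs

section fin
variable {K K' : ℂ} (hτ : 0 < (I * K' / K).im)
include hτ

lemma HJ_cont : Continuous (HJ K K') :=
  (theta1_diff hτ).continuous.comp (by fun_prop : Continuous fun z : ℂ => (Real.pi : ℂ) * z / (2 * K))

lemma ΘJ_cont : Continuous (ΘJ K K') :=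
  (theta4_diff hτ).continuous.comp (by fun_prop : Continuous fun z : ℂ => (Real.pi : ℂ) * z / (2 * K))

lemma hJ_freq (a x : ℂ) : ∀ᶠ z in nhdsWithin x {x}ᶜ, hJ K K' (z + a) ≠ 0 := by
  have hK : K ≠ 0 := by
    rintro rfl
    simp at hτ
  have hp : (Real.pi : ℂ) / (2 * K) ≠ 0 := by
    have : (Real.pi : ℂ) ≠ 0 := by exact_mod_cast Real.pi_ne_zero
    exact div_ne_zero this (mul_ne_zero two_ne_zero hK)
  filter_upwards [theta_freq hτ _ ((Real.pi : ℂ) / (2 * K) * a) hp x] with z hz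
  have e : (Real.pi : ℂ) * (z + a) / (2 * K) =
      (Real.pi : ℂ) / (2 * K) * z + (Real.pi : ℂ) / (2 * K) * a := by ring
  have h0 := theta40_ne hτ
  simp only [hJ, gJ, HJ, ΘJ, e, mul_zero, zero_div]
  exact mul_ne_zero hz h0

lemma w_cont (η : ℂ) : Continuous (w4p3 K K' η) ∧ Continuous (w4m3 K K' η) ∧
    Continuous (w1p2 K K' η) ∧ Continuous (w1m2 K K' η) := by
  have h1 := HJ_cont hτ
  have h2 := ΘJ_cont hτ
  unfold w4p3 w4m3 w1p2 w1m2
  refine ⟨?_, ?_, ?_, ?_⟩ <;> fun_prop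

lemma Lop_cont (η : ℂ) (L : ℕ) (n : Fin L) : Continuous (Lop K K' η L n) := by
  obtain ⟨h1, h2, h3, h4⟩ := w_cont hτ η
  have : Lop K K' η L n = fun μ => (Lsite K K' η μ).map (embed L n) := rfl
  rw [this]
  have key : ∀ i j a b, Continuous fun μ => Lsite K K' η μ i j a b := by
    intro i j a b
    simp only [Lsite_eq]
    fin_cases i <;> fin_cases j <;> fin_cases a <;> fin_cases b <;> simp <;>
      first
      | exact continuous_const
      | exact h1
      | exact h2
      | exact h3
      | exact h4
  refine continuous_matrix fun i j => continuous_matrix fun f g => ?_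
  simp only [Matrix.map_apply, embed, Matrix.of_apply]
  exact (key i j _ _).mul continuous_const

lemma Tm_cont (η : ℂ) (L : ℕ) : Continuous (Tm K K' η L) := by
  have : Tm K K' η L = fun μ =>
      (((List.finRange L).map Fin.rev).map fun m => Lop K K' η L m μ).prod := by
    ext1 μ
    exact Tm_eq _ _ _ _ _
  rw [this]
  exact continuous_list_prod _ fun i _ => Lop_cont hτ η L i

lemma bil_cont (η : ℂ) (L : ℕ) (y x : ℂ → Fin 2 → ℂ) (hy : Continuous y) (hx : Continuous x) :
    Continuous fun μ => bil (y μ) (x μ) (Tm K K' η L μ) := by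
  unfold bil
  have h := Tm_cont hτ η L
  refine continuous_finsetSum _ fun i _ => continuous_finsetSum _ fun j _ => ?_
  have h1 : Continuous fun μ => y μ i * x μ j :=
    ((continuous_apply i).comp hy).mul ((continuous_apply j).comp hx)
  exact h1.smul (h.matrix_elem i j)

lemma vJ_cont : Continuous (vJ K K') := by
  have h1 := HJ_cont hτ
  have h2 := ΘJ_cont hτ
  refine continuous_pi fun i => ?_
  fin_cases i
  · exact h1
  · exact h2

lemma zJ_cont : Continuous (zJ K K') := by
  have h1 := HJ_cont hτ
  have h2 := ΘJ_cont hτ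
  refine continuous_pi fun i => ?_
  fin_cases i
  · exact h2
  · exact h1.neg

lemma remove_h {L : ℕ} (a : ℂ) (F G : ℂ → OpC L) (hF : Continuous F) (hG : Continuous G)
    (h : ∀ z, hJ K K' (z + a) • (F z - G z) = 0) (x : ℂ) : F x = G x := by
  have h1 : ∀ᶠ z in nhdsWithin x {x}ᶜ, F z = G z := by
    filter_upwards [hJ_freq hτ a x] with z hz
    exact sub_eq_zero.1 ((smul_eq_zero.1 (h z)).resolve_left hz)
  have t1 : Filter.Tendsto F (nhdsWithin x {x}ᶜ) (nhds (F x)) :=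
    hF.continuousAt.mono_left nhdsWithin_le_nhds
  have t2 : Filter.Tendsto G (nhdsWithin x {x}ᶜ) (nhds (G x)) :=
    hG.continuousAt.mono_left nhdsWithin_le_nhds
  exact tendsto_nhds_unique_of_eventuallyEq t1 t2 h1

lemma bb (η t : ℂ) (L : ℕ) (k l : ℤ) (lam mu : ℂ) :
    bil (zJ K K' (t + 2 * (k : ℂ) * η + lam)) (vJ K K' (t + 2 * ((l + 1 : ℤ) : ℂ) * η + lam))
        (Tm K K' η L lam) *
      bil (zJ K K' (t + 2 * ((k + 1 : ℤ) : ℂ) * η + mu)) (vJ K K' (t + 2 * (l : ℂ) * η + mu))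
        (Tm K K' η L mu) =
    bil (zJ K K' (t + 2 * (k : ℂ) * η + mu)) (vJ K K' (t + 2 * ((l + 1 : ℤ) : ℂ) * η + mu))
        (Tm K K' η L mu) *
      bil (zJ K K' (t + 2 * ((k + 1 : ℤ) : ℂ) * η + lam)) (vJ K K' (t + 2 * (l : ℂ) * η + lam))
        (Tm K K' η L lam) := by
  have hv := vJ_cont hτ
  have hz := zJ_cont hτ
  refine remove_h hτ (-mu + 2 * η)
    (fun lam => bil (zJ K K' (t + 2 * (k : ℂ) * η + lam))
      (vJ K K' (t + 2 * ((l + 1 : ℤ) : ℂ) * η + lam)) (Tm K K' η L lam) *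
      bil (zJ K K' (t + 2 * ((k + 1 : ℤ) : ℂ) * η + mu)) (vJ K K' (t + 2 * (l : ℂ) * η + mu))
        (Tm K K' η L mu))
    (fun lam => bil (zJ K K' (t + 2 * (k : ℂ) * η + mu))
      (vJ K K' (t + 2 * ((l + 1 : ℤ) : ℂ) * η + mu)) (Tm K K' η L mu) *
      bil (zJ K K' (t + 2 * ((k + 1 : ℤ) : ℂ) * η + lam)) (vJ K K' (t + 2 * (l : ℂ) * η + lam))
        (Tm K K' η L lam)) ?_ ?_ ?_ lam
  · exact (bil_cont hτ η L _ _ (by fun_prop) (by fun_prop)).mul continuous_const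
  · exact continuous_const.mul (bil_cont hτ η L _ _ (by fun_prop) (by fun_prop))
  · intro lam
    rw [show lam + (-mu + 2 * η) = lam - mu + 2 * η by ring]
    refine key_alg (RTT_Tm hτ η L lam mu) _ ?_ ?_
    · have := irfZ' hτ η lam mu (t + 2 * (k : ℂ) * η + lam) (t + 2 * (k : ℂ) * η + mu) (by ring)
      convert this using 3
      · congr 1
        push_cast
        ring
      · congr 1
        push_cast
        ring
    · have := irfV hτ η lam mu (t + 2 * (l : ℂ) * η + lam) (t + 2 * (l : ℂ) * η + mu) (by ring)
      convert this using 3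
      · congr 1
        push_cast
        ring
      · congr 1
        push_cast
        ring

lemma cc (η s : ℂ) (L : ℕ) (k l : ℤ) (lam mu : ℂ) :
    bil (zJ K K' (s + 2 * ((k + 1 : ℤ) : ℂ) * η - lam)) (vJ K K' (s + 2 * (l : ℂ) * η - lam))
        (Tm K K' η L lam) *
      bil (zJ K K' (s + 2 * (k : ℂ) * η - mu)) (vJ K K' (s + 2 * ((l + 1 : ℤ) : ℂ) * η - mu))
        (Tm K K' η L mu) =
    bil (zJ K K' (s + 2 * ((k + 1 : ℤ) : ℂ) * η - mu)) (vJ K K' (s + 2 * (l : ℂ) * η - mu))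
        (Tm K K' η L mu) *
      bil (zJ K K' (s + 2 * (k : ℂ) * η - lam)) (vJ K K' (s + 2 * ((l + 1 : ℤ) : ℂ) * η - lam))
        (Tm K K' η L lam) := by
  have hv := vJ_cont hτ
  have hz := zJ_cont hτ
  refine remove_h hτ (-mu + 2 * η)
    (fun lam => bil (zJ K K' (s + 2 * ((k + 1 : ℤ) : ℂ) * η - lam))
      (vJ K K' (s + 2 * (l : ℂ) * η - lam)) (Tm K K' η L lam) *
      bil (zJ K K' (s + 2 * (k : ℂ) * η - mu)) (vJ K K' (s + 2 * ((l + 1 : ℤ) : ℂ) * η - mu))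
        (Tm K K' η L mu))
    (fun lam => bil (zJ K K' (s + 2 * ((k + 1 : ℤ) : ℂ) * η - mu))
      (vJ K K' (s + 2 * (l : ℂ) * η - mu)) (Tm K K' η L mu) *
      bil (zJ K K' (s + 2 * (k : ℂ) * η - lam)) (vJ K K' (s + 2 * ((l + 1 : ℤ) : ℂ) * η - lam))
        (Tm K K' η L lam)) ?_ ?_ ?_ lam
  · exact (bil_cont hτ η L _ _ (by fun_prop) (by fun_prop)).mul continuous_const
  · exact continuous_const.mul (bil_cont hτ η L _ _ (by fun_prop) (by fun_prop))
  · intro lam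
    rw [show lam + (-mu + 2 * η) = lam - mu + 2 * η by ring]
    refine key_alg (RTT_Tm hτ η L lam mu) _ ?_ ?_
    · have := irfZ hτ η lam mu (s + 2 * (k : ℂ) * η - mu) (s + 2 * (k : ℂ) * η - lam) (by ring)
      convert this using 3
      · congr 1
        push_cast
        ring
      · congr 1
        push_cast
        ring
    · have := irfV' hτ η lam mu (s + 2 * (l : ℂ) * η - mu) (s + 2 * (l : ℂ) * η - lam) (by ring)
      convert this using 3
      · congr 1
        push_cast
        ring
      · congr 1
        push_cast
        ring

lemma det_fac (η s t : ℂ) : ∃ (φ : ℤ → ℂ) (ψ : ℂ → ℂ), ∀ k lam,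
    (Mg K K' η s t k lam).det = φ k * ψ lam := by
  refine ⟨fun k => (gJ K K' (τJ K η s t k))⁻¹ * (-I *
    (ThE ((Real.pi : ℂ) * (s + t + 4 * k * η) / (2 * K) / 2) (I * K' / K)
      + ThE (-((Real.pi : ℂ) * (s + t + 4 * k * η) / (2 * K) / 2)) (I * K' / K))),
    fun lam => (ThE ((Real.pi : ℂ) * (s - t - 2 * lam) / (2 * K) / 2) (I * K' / K)
      - ThE (-((Real.pi : ℂ) * (s - t - 2 * lam) / (2 * K) / 2)) (I * K' / K)), fun k lam => ?_⟩
  have := wron hτ ((Real.pi : ℂ) * (s + 2 * k * η - lam) / (2 * K))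
    ((Real.pi : ℂ) * (t + 2 * k * η + lam) / (2 * K))
  rw [← add_div, ← sub_div, ← mul_add, ← mul_sub,
    show s + 2 * k * η - lam + (t + 2 * k * η + lam) = s + t + 4 * k * η by ring,
    show s + 2 * k * η - lam - (t + 2 * k * η + lam) = s - t - 2 * lam by ring] at this
  rw [Mg, Matrix.det_fin_two_of]
  simp only [HJ, ΘJ]
  linear_combination (gJ K K' (τJ K η s t k))⁻¹ * this
end fin

lemma Bg_eq (K K' η s t : ℂ) (L : ℕ) (k l : ℤ) (lam : ℂ) : Bg K K' η s t L k l lam =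
    ((Mg K K' η s t k lam).det⁻¹ * (gJ K K' (τJ K η s t k))⁻¹ * (gJ K K' (τJ K η s t l))⁻¹) •
      bil (zJ K K' (t + 2 * (k : ℂ) * η + lam)) (vJ K K' (t + 2 * (l : ℂ) * η + lam))
        (Tm K K' η L lam) := by
  rw [Bg, Tg, Matrix.inv_def, Ring.inverse_eq_inv']
  generalize (Mg K K' η s t k lam).det = D
  simp only [toOp, Matrix.mul_apply, Fin.sum_univ_two, bil, zJ, vJ, Mg, Matrix.adjugate_fin_two_of,
    Matrix.map_apply, Matrix.smul_apply, add_mul, mul_add, smul_mul_assoc, mul_smul_comm,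
    one_mul, mul_one]
  simp
  module

lemma Cg_eq (K K' η s t : ℂ) (L : ℕ) (k l : ℤ) (lam : ℂ) : Cg K K' η s t L k l lam =
    (-(Mg K K' η s t k lam).det⁻¹) •
      bil (zJ K K' (s + 2 * (k : ℂ) * η - lam)) (vJ K K' (s + 2 * (l : ℂ) * η - lam))
        (Tm K K' η L lam) := by
  rw [Cg, Tg, Matrix.inv_def, Ring.inverse_eq_inv']
  generalize (Mg K K' η s t k lam).det = D
  simp only [toOp, Matrix.mul_apply, Fin.sum_univ_two, bil, zJ, vJ, Mg, Matrix.adjugate_fin_two_of,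
    Matrix.map_apply, Matrix.smul_apply, add_mul, mul_add, smul_mul_assoc, mul_smul_comm,
    one_mul, mul_one]
  simp
  module

/-- `B_{k,l+1}(λ)B_{k+1,l}(μ) = B_{k,l+1}(μ)B_{k+1,l}(λ)` and
`C_{k+1,l}(λ)C_{k,l+1}(μ) = C_{k+1,l}(μ)C_{k,l+1}(λ)` for all λ, μ ∈ ℂ and k, l ∈ ℤ. -/
theorem BB_CC_commutation (K K' η s t : ℂ) (hτ : 0 < (Complex.I * K' / K).im)
    (Q : ℕ) (hQ : 0 < Q) (hη : (Q : ℂ) * η = 2 * K) (L : ℕ) :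
    ∀ (lam mu : ℂ) (k l : ℤ),
      Bg K K' η s t L k (l + 1) lam * Bg K K' η s t L (k + 1) l mu =
          Bg K K' η s t L k (l + 1) mu * Bg K K' η s t L (k + 1) l lam ∧
      Cg K K' η s t L (k + 1) l lam * Cg K K' η s t L k (l + 1) mu =
          Cg K K' η s t L (k + 1) l mu * Cg K K' η s t L k (l + 1) lam := by
  intro lam mu k l
  obtain ⟨φ, ψ, hd⟩ := det_fac hτ η s t
  constructor
  · simp only [Bg_eq, smul_mul_assoc, mul_smul_comm, smul_smul, hd, mul_inv]
    rw [bb hτ η t L k l lam mu]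
    congr 1
    ring
  · simp only [Cg_eq, smul_mul_assoc, mul_smul_comm, smul_smul, hd, mul_inv]
    rw [cc hτ η s L k l lam mu]
    congr 1
    ring

end
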